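/- arXiv:1901.09713 — 6 statements merged into one kernel-verified Lean document; each statement's English description precedes it below -/
import Mathlib

section
/- Let T be a triangulated category and let Z →^v Z →^ε N →^δ Z⟦1⟧ be a distinguished triangle (so N is the cone of the endomorphism v of Z). Then there is a distinguished triangle Z → Z ⊕ N → Z⟦1⟧ ⊕ Z → Z⟦1⟧ whose first morphism has Z-component 0 and N-component ε. In particular N ≤_{Δ+nil} Z ⊕ Z⟦1⟧. -/
open CategoryTheory Category Limits Pretriangulated

/-- An endomorphism `v` of `Z` is nilpotent if some positive power of it
(in the endomorphism ring `End Z`) vanishes. -/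
def IsNilpotentEndo {T : Type*} [Category T] [Preadditive T] {Z : T} (v : Z ⟶ Z) : Prop :=
  ∃ n : ℕ, 0 < n ∧ (show End Z from v) ^ n = 0

/-- `M ≤_{Δ+nil} N` : there are an object `Z` and a distinguished triangle
`Z → Z ⊕ M → N → Z⟦1⟧` whose first morphism has components `v : Z ⟶ Z` and
`u : Z ⟶ M` with `v` nilpotent. -/
def DegNil (T : Type*) [Category T] [Preadditive T] [HasZeroObject T] [HasShift T ℤ]
    [∀ n : ℤ, (shiftFunctor T n).Additive] [Pretriangulated T] [HasBinaryBiproducts T]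
    (M N : T) : Prop :=
  ∃ (Z : T) (v : Z ⟶ Z) (u : Z ⟶ M) (g : Z ⊞ M ⟶ N) (h : N ⟶ Z⟦(1 : ℤ)⟧),
    IsNilpotentEndo v ∧ Triangle.mk (biprod.lift v u) g h ∈ distTriang T

/-- A triangle obtained from a distinguished triangle by replacing its second and third objects
by isomorphic ones is distinguished. -/
lemma distTriang_of_iso₂₃ {T : Type*} [Category T] [Preadditive T]
    [HasZeroObject T] [HasShift T ℤ] [∀ n : ℤ, (shiftFunctor T n).Additive] [Pretriangulated T]
    {X Y Y' C C' : T} {f : X ⟶ Y} {g : Y ⟶ C} {h : C ⟶ X⟦(1 : ℤ)⟧}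
    (hd : Triangle.mk f g h ∈ distTriang T) (e : Y' ≅ Y) (e' : C' ≅ C)
    {f' : X ⟶ Y'} {g' : Y' ⟶ C'} {h' : C' ⟶ X⟦(1 : ℤ)⟧}
    (hf : f' ≫ e.hom = f) (hg : g' ≫ e'.hom = e.hom ≫ g) (hh : h' = e'.hom ≫ h) :
    Triangle.mk f' g' h' ∈ distTriang T := by
  refine isomorphic_distinguished _ hd _ (Triangle.isoMk _ _ (Iso.refl _) e e' ?_ hg ?_)
  · exact hf.trans (id_comp f).symm
  · change h' ≫ (𝟙 X)⟦(1 : ℤ)⟧' = e'.hom ≫ h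
    simp [hh]

/-- The cone of a morphism `(0, f) : X ⟶ W ⊞ Y` is the direct sum of the cone of `f` and `W`. -/
lemma exists_distTriang_biprod_lift_zero {T : Type*} [Category T] [Preadditive T]
    [HasZeroObject T] [HasShift T ℤ] [∀ n : ℤ, (shiftFunctor T n).Additive] [Pretriangulated T]
    [IsTriangulated T] [HasBinaryBiproducts T] (W : T) {X Y C : T} (f : X ⟶ Y) (p : Y ⟶ C)
    (q : C ⟶ X⟦(1 : ℤ)⟧) (hf : Triangle.mk f p q ∈ distTriang T) :
    ∃ (g : W ⊞ Y ⟶ C ⊞ W) (h : C ⊞ W ⟶ X⟦(1 : ℤ)⟧),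
      Triangle.mk (biprod.lift (0 : X ⟶ W) f) g h ∈ distTriang T := by
  obtain ⟨K, g, h, hK⟩ := distinguished_cocone_triangle (biprod.lift (0 : X ⟶ W) f)
  have hW : Triangle.mk (biprod.inr : Y ⟶ W ⊞ Y) biprod.fst 0 ∈ distTriang T :=
    distTriang_of_iso₂₃ (binaryBiproductTriangle_distinguished Y W) (biprod.braiding W Y)
      (Iso.refl W) (by ext <;> simp) (by simp) (by simp)
  have comm : f ≫ (biprod.inr : Y ⟶ W ⊞ Y) = biprod.lift 0 f := by
    ext <;> simp
  let oct := Triangulated.someOctahedron comm hf hW hK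
  obtain ⟨e : K ≅ C ⊞ W, -, -⟩ :=
    exists_iso_binaryBiproduct_of_distTriang _ oct.mem zero_comp
  exact ⟨g ≫ e.hom, e.inv ≫ h,
    distTriang_of_iso₂₃ hK (Iso.refl _) e.symm (by simp) (by simp) rfl⟩

/-- given a distinguished triangle `Z →^v Z →^ε N →^δ Z⟦1⟧`, there is a
distinguished triangle `Z → Z ⊕ N → Z⟦1⟧ ⊕ Z → Z⟦1⟧` whose first morphism has
`Z`-component `0` and `N`-component `ε`; in particular `N ≤_{Δ+nil} Z ⊕ Z⟦1⟧`. -/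
theorem stmt1 {T : Type*} [Category T] [Preadditive T] [HasZeroObject T] [HasShift T ℤ]
    [∀ n : ℤ, (shiftFunctor T n).Additive] [Pretriangulated T] [IsTriangulated T]
    [HasBinaryBiproducts T]
    (Z N : T) (v : Z ⟶ Z) (ε : Z ⟶ N) (δ : N ⟶ Z⟦(1 : ℤ)⟧)
    (hT : Triangle.mk v ε δ ∈ distTriang T) :
    (∃ (g : Z ⊞ N ⟶ Z⟦(1 : ℤ)⟧ ⊞ Z) (h : Z⟦(1 : ℤ)⟧ ⊞ Z ⟶ Z⟦(1 : ℤ)⟧),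
        Triangle.mk (biprod.lift (0 : Z ⟶ Z) ε) g h ∈ distTriang T) ∧
      DegNil T N (Z ⊞ Z⟦(1 : ℤ)⟧) := by
  obtain ⟨g, h, hd⟩ := exists_distTriang_biprod_lift_zero Z ε δ (-v⟦(1 : ℤ)⟧')
    (rot_of_distTriang _ hT)
  let e := biprod.braiding Z (Z⟦(1 : ℤ)⟧)
  exact ⟨⟨g, h, hd⟩, Z, 0, ε, g ≫ e.inv, e.hom ≫ h, ⟨1, one_pos, pow_one _⟩,
    distTriang_of_iso₂₃ hd (Iso.refl _) e (by simp) (by simp) rfl⟩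
end

section
/- Let T be a triangulated category, let Z →^v Z →^μ C → Z⟦1⟧ be a distinguished triangle and let u : M → Z be any morphism. Then there exist an object N and morphisms σ : N → M and w : N → Z such that: (a) the triangle N → M ⊕ Z → Z → N⟦1⟧, whose first morphism has components σ and w and whose second morphism has components u : M → Z and −v : Z → Z, is distinguished (so the square with sides σ, w, u, v is homotopy cartesian), and (b) the morphism σ : N → M fits into a distinguished triangle N →^σ M → C → N⟦1⟧ in which the map M → C is μ ∘ u. In particular, if v is nilpotent then M ≤_{Δ+nil,right} N: the homotopy pullback of v along u is a degeneration of M. -/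
open CategoryTheory Category Limits Pretriangulated

/-- `M ≤_{Δ+nil,right} N` : there are an object `Z'` and a distinguished triangle
`N → M ⊕ Z' → Z' → N⟦1⟧` whose second morphism has components `u' : M ⟶ Z'` and
`v' : Z' ⟶ Z'`, with `v'` nilpotent. -/
def DegNilRight (T : Type*) [Category T] [Preadditive T] [HasZeroObject T] [HasShift T ℤ]
    [∀ n : ℤ, (shiftFunctor T n).Additive] [Pretriangulated T] [HasBinaryBiproducts T]
    (M N : T) : Prop :=
  ∃ (Z' : T) (f : N ⟶ M ⊞ Z') (u' : M ⟶ Z') (v' : Z' ⟶ Z') (h : Z' ⟶ N⟦(1 : ℤ)⟧),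
    IsNilpotentEndo v' ∧ Triangle.mk f (biprod.desc u' v') h ∈ distTriang T

lemma IsNilpotentEndo.neg {T : Type*} [Category T] [Preadditive T] {Z : T} {v : Z ⟶ Z} (hv : IsNilpotentEndo v) :
    IsNilpotentEndo (-v) := by
  obtain ⟨n, hn, h⟩ := hv
  refine ⟨n, hn, ?_⟩
  change (-(show End Z from v)) ^ n = 0
  rw [neg_pow, h, mul_zero]

section

variable {T : Type*} [Category T] [Preadditive T] [HasZeroObject T] [HasShift T ℤ]
  [∀ n : ℤ, (shiftFunctor T n).Additive] [Pretriangulated T]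

lemma biprod_inr_fst_distinguished [HasBinaryBiproducts T] (M Z : T) :
    Triangle.mk (biprod.inr : Z ⟶ M ⊞ Z) biprod.fst (0 : M ⟶ Z⟦(1 : ℤ)⟧) ∈ distTriang T :=
  isomorphic_distinguished _ (binaryBiproductTriangle_distinguished Z M) _
    (Triangle.isoMk _ _ (Iso.refl Z) (biprod.braiding M Z) (Iso.refl M)
      (show biprod.inr ≫ (biprod.braiding M Z).hom = 𝟙 Z ≫ biprod.inl by ext <;> simp)
      (show biprod.fst ≫ 𝟙 M = (biprod.braiding M Z).hom ≫ biprod.snd by simp)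
      (show (0 : M ⟶ Z⟦(1 : ℤ)⟧) ≫ (𝟙 Z)⟦1⟧' = 𝟙 M ≫ 0 by simp))

lemma distinguished_neg_first_third {X Y C : T} {f : X ⟶ Y} {g : Y ⟶ C} {h : C ⟶ X⟦(1 : ℤ)⟧}
    (hT : Triangle.mk f g h ∈ distTriang T) : Triangle.mk (-f) g (-h) ∈ distTriang T :=
  isomorphic_distinguished _ hT _
    (Triangle.isoMk _ _ (-(Iso.refl X)) (Iso.refl Y) (Iso.refl C)
      (show (-f) ≫ 𝟙 Y = (-𝟙 X) ≫ f by simp)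
      (show g ≫ 𝟙 C = 𝟙 Y ≫ g by simp)
      (show (-h) ≫ (-𝟙 X)⟦1⟧' = 𝟙 C ≫ h by simp))

/-- The octahedron axiom applied to a composition `Z ⟶ M ⊞ Z ⟶ Y` starting with the inclusion
of the second summand: the fibre of `biprod.desc u f` maps to `M` with cone the cone of `f`. -/
lemma exists_distinguished_of_biprod_desc [IsTriangulated T] [HasBinaryBiproducts T]
    {M Z Y C N : T} {u : M ⟶ Y} {f : Z ⟶ Y} {g : Y ⟶ C} {h : C ⟶ Z⟦(1 : ℤ)⟧}
    (hT : Triangle.mk f g h ∈ distTriang T) {σ : N ⟶ M} {w : N ⟶ Z} {θ : Y ⟶ N⟦(1 : ℤ)⟧}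
    (hN : Triangle.mk (biprod.lift σ w) (biprod.desc u f) θ ∈ distTriang T) :
    ∃ δ : C ⟶ N⟦(1 : ℤ)⟧, Triangle.mk σ (u ≫ g) δ ∈ distTriang T := by
  let O := Triangulated.someOctahedron (biprod.inr_desc u f)
    (biprod_inr_fst_distinguished M Z) (rot_of_distTriang _ hN) hT
  have hm : O.m₁ = u ≫ g := by
    simpa using (biprod.inl : M ⟶ M ⊞ Z) ≫= O.comm₁
  refine ⟨O.m₃, (rotate_distinguished_triangle _).2 ?_⟩
  have hO := O.mem
  rw [hm] at hO
  have hσ : (-(biprod.lift σ w)⟦(1 : ℤ)⟧') ≫ (biprod.fst : M ⊞ Z ⟶ M)⟦(1 : ℤ)⟧' =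
      -σ⟦(1 : ℤ)⟧' := by
    rw [Preadditive.neg_comp, ← Functor.map_comp, biprod.lift_fst]
  change Triangle.mk (u ≫ g) O.m₃ (-σ⟦(1 : ℤ)⟧') ∈ distTriang T
  rw [← hσ]
  exact hO

end

/-- given a distinguished triangle `Z →^v Z →^μ C → Z⟦1⟧` and a morphism
`u : M ⟶ Z`, there exist an object `N` (the homotopy pullback of `v` along `u`) and
morphisms `σ : N ⟶ M`, `w : N ⟶ Z` such that (a) the triangle
`N → M ⊕ Z → Z → N⟦1⟧` with first map of components `σ, w` and second map of
components `u, −v` is distinguished, and (b) `σ` fits into a distinguished triangle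
`N →^σ M → C → N⟦1⟧` whose map `M ⟶ C` is `μ ∘ u`. In particular, if `v` is
nilpotent then `M ≤_{Δ+nil,right} N`. -/
theorem stmt3 {T : Type*} [Category T] [Preadditive T] [HasZeroObject T] [HasShift T ℤ]
    [∀ n : ℤ, (shiftFunctor T n).Additive] [Pretriangulated T] [IsTriangulated T]
    [HasBinaryBiproducts T]
    (Z C M : T) (v : Z ⟶ Z) (μ : Z ⟶ C) (hC : C ⟶ Z⟦(1 : ℤ)⟧)
    (hT : Triangle.mk v μ hC ∈ distTriang T) (u : M ⟶ Z) :
    ∃ (N : T) (σ : N ⟶ M) (w : N ⟶ Z) (θ : Z ⟶ N⟦(1 : ℤ)⟧) (δ : C ⟶ N⟦(1 : ℤ)⟧),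
      (Triangle.mk (biprod.lift σ w) (biprod.desc u (-v)) θ ∈ distTriang T) ∧
      (Triangle.mk σ (u ≫ μ) δ ∈ distTriang T) ∧
      (IsNilpotentEndo v → DegNilRight T M N) := by
  obtain ⟨N, ι, θ, hN⟩ := distinguished_cocone_triangle₁ (biprod.desc u (-v))
  obtain ⟨σ, w, rfl⟩ : ∃ (σ : N ⟶ M) (w : N ⟶ Z), ι = biprod.lift σ w :=
    ⟨ι ≫ biprod.fst, ι ≫ biprod.snd, by ext <;> simp⟩
  obtain ⟨δ, hδ⟩ := exists_distinguished_of_biprod_desc (distinguished_neg_first_third hT) hN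
  exact ⟨N, σ, w, θ, δ, hN, hδ, fun hv => ⟨Z, _, u, -v, θ, hv.neg, hN⟩⟩
end

section
/- Let T be a triangulated category and let A →^f B →^g C →^h A⟦1⟧ be a distinguished triangle. Then there exists a distinguished triangle A → A ⊕ B → A ⊕ C → A⟦1⟧ whose first morphism has A-component 0 and B-component f. In particular B ≤_{Δ+nil} A ⊕ C. -/
open CategoryTheory Category Limits Pretriangulated

/-- Transport of a distinguished triangle along isomorphisms of its second and third objects. -/
lemma distTriang_mk_of_iso₂₃ {T : Type*} [Category T] [Preadditive T] [HasZeroObject T]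
    [HasShift T ℤ] [∀ n : ℤ, (shiftFunctor T n).Additive] [Pretriangulated T]
    {X Y Z Y' Z' : T} {f : X ⟶ Y} {g : Y ⟶ Z} {h : Z ⟶ X⟦(1 : ℤ)⟧}
    (hT : Triangle.mk f g h ∈ distTriang T) (e₂ : Y ≅ Y') (e₃ : Z ≅ Z')
    {f' : X ⟶ Y'} {g' : Y' ⟶ Z'} {h' : Z' ⟶ X⟦(1 : ℤ)⟧}
    (hf : f ≫ e₂.hom = f') (hg : g ≫ e₃.hom = e₂.hom ≫ g') (hh : h = e₃.hom ≫ h') :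
    Triangle.mk f' g' h' ∈ distTriang T := by
  have comm₁ : f ≫ e₂.hom = 𝟙 X ≫ f' := by rw [hf, id_comp]
  have comm₃ : h ≫ (𝟙 X)⟦(1 : ℤ)⟧' = e₃.hom ≫ h' := by
    rw [CategoryTheory.Functor.map_id, comp_id, hh]
  exact isomorphic_distinguished _ hT _
    (Triangle.isoMk (Triangle.mk f g h) (Triangle.mk f' g' h') (Iso.refl X) e₂ e₃
      comm₁ hg comm₃).symm

/-- for every distinguished triangle `A →^f B →^g C →^h A⟦1⟧` there is a
distinguished triangle `A → A ⊕ B → A ⊕ C → A⟦1⟧` whose first morphism has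
`A`-component `0` and `B`-component `f`; in particular `B ≤_{Δ+nil} A ⊕ C`. -/
theorem stmt6 {T : Type*} [Category T] [Preadditive T] [HasZeroObject T] [HasShift T ℤ]
    [∀ n : ℤ, (shiftFunctor T n).Additive] [Pretriangulated T] [IsTriangulated T]
    [HasBinaryBiproducts T]
    (A B C : T) (f : A ⟶ B) (g : B ⟶ C) (h : C ⟶ A⟦(1 : ℤ)⟧)
    (hT : Triangle.mk f g h ∈ distTriang T) :
    (∃ (g' : A ⊞ B ⟶ A ⊞ C) (h' : A ⊞ C ⟶ A⟦(1 : ℤ)⟧),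
        Triangle.mk (biprod.lift (0 : A ⟶ A) f) g' h' ∈ distTriang T) ∧
      DegNil T B (A ⊞ C) := by
  have hBA : Triangle.mk (biprod.inr : B ⟶ A ⊞ B) (biprod.fst : A ⊞ B ⟶ A)
      (0 : A ⟶ B⟦(1 : ℤ)⟧) ∈ distTriang T :=
    distTriang_mk_of_iso₂₃ (binaryBiproductTriangle_distinguished B A) (biprod.braiding B A)
      (Iso.refl A) (by ext <;> simp) (by simp) (by simp)
  obtain ⟨N, p, q, hN⟩ := distinguished_cocone_triangle (biprod.lift (0 : A ⟶ A) f)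
  have hcomp : f ≫ (biprod.inr : B ⟶ A ⊞ B) = biprod.lift 0 f := by
    ext <;> simp
  have o := Triangulated.someOctahedron hcomp hT hBA hN
  obtain ⟨e, -, -⟩ := exists_iso_binaryBiproduct_of_distTriang _ o.mem zero_comp
  let e' : N ≅ A ⊞ C := e ≪≫ biprod.braiding C A
  have hD : Triangle.mk (biprod.lift (0 : A ⟶ A) f) (p ≫ e'.hom) (e'.inv ≫ q) ∈ distTriang T :=
    distTriang_mk_of_iso₂₃ hN (Iso.refl _) e' (by simp) (by simp) (by simp)
  exact ⟨⟨_, _, hD⟩, A, 0, f, _, _, ⟨1, one_pos, pow_one _⟩, hD⟩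
end

section
/- Let T be a triangulated category, n ≥ 1, and suppose given objects M₀ = 0, M₁, …, Mₙ = M, morphisms f_k : M_{k−1} → M_k, and distinguished triangles M_{k−1} →^{f_k} M_k → C_k → M_{k−1}⟦1⟧ for k = 1, …, n. Then there is a distinguished triangle (⊕_{k=1}^{n−1} M_k) → M ⊕ (⊕_{k=1}^{n−1} M_k) → (⊕_{k=1}^{n} C_k) → (⊕_{k=1}^{n−1} M_k)⟦1⟧ induced by the direct sum of the f_k. In particular M ≤_Δ ⊕_{k=1}^{n} C_k. -/
open CategoryTheory Category Limits Pretriangulated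

/-- `M ≤_Δ N` : there are an object `Z` and a distinguished triangle
`Z → Z ⊕ M → N → Z⟦1⟧` whose first morphism has components `v : Z ⟶ Z` and
`u : Z ⟶ M`. -/
def Deg (T : Type*) [Category T] [Preadditive T] [HasZeroObject T] [HasShift T ℤ]
    [∀ n : ℤ, (shiftFunctor T n).Additive] [Pretriangulated T] [HasBinaryBiproducts T]
    (M N : T) : Prop :=
  ∃ (Z : T) (v : Z ⟶ Z) (u : Z ⟶ M) (g : Z ⊞ M ⟶ N) (h : N ⟶ Z⟦(1 : ℤ)⟧),
    Triangle.mk (biprod.lift v u) g h ∈ distTriang T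

/-- The first morphism of a distinguished triangle may be replaced by an isomorphic one, and the
third object by an isomorphic object. -/
lemma exists_distinguished_of_iso {T : Type*} [Category T] [Preadditive T] [HasZeroObject T]
    [HasShift T ℤ] [∀ n : ℤ, (shiftFunctor T n).Additive] [Pretriangulated T]
    {S : Triangle T} (hS : S ∈ distTriang T) {X Y Z : T} (f : X ⟶ Y)
    (e₁ : X ≅ S.obj₁) (e₂ : Y ≅ S.obj₂) (e₃ : Z ≅ S.obj₃) (comm : f ≫ e₂.hom = e₁.hom ≫ S.mor₁) :
    ∃ (g : Y ⟶ Z) (h : Z ⟶ X⟦(1 : ℤ)⟧), Triangle.mk f g h ∈ distTriang T := by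
  refine ⟨e₂.hom ≫ S.mor₂ ≫ e₃.inv, e₃.hom ≫ S.mor₃ ≫ e₁.inv⟦(1 : ℤ)⟧', ?_⟩
  have comm₂ : (e₂.hom ≫ S.mor₂ ≫ e₃.inv) ≫ e₃.hom = e₂.hom ≫ S.mor₂ := by simp
  have comm₃ : (e₃.hom ≫ S.mor₃ ≫ e₁.inv⟦(1 : ℤ)⟧') ≫ e₁.hom⟦(1 : ℤ)⟧' = e₃.hom ≫ S.mor₃ := by
    simp [← Functor.map_comp]
  exact isomorphic_distinguished _ hS _ (Triangle.isoMk _ _ e₁ e₂ e₃ comm comm₂ comm₃)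

/-- A finite direct sum of distinguished triangles is distinguished. -/
lemma exists_distinguished_biproduct_map {T : Type*} [Category T] [Preadditive T]
    [HasZeroObject T] [HasShift T ℤ] [∀ n : ℤ, (shiftFunctor T n).Additive] [Pretriangulated T]
    [HasFiniteBiproducts T] {J : Type} [Finite J] (S : J → Triangle T)
    (hS : ∀ j, S j ∈ distTriang T) :
    ∃ (G : (⨁ fun j => (S j).obj₂) ⟶ ⨁ fun j => (S j).obj₃)
      (H : (⨁ fun j => (S j).obj₃) ⟶ (⨁ fun j => (S j).obj₁)⟦(1 : ℤ)⟧),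
      Triangle.mk (biproduct.map fun j => (S j).mor₁) G H ∈ distTriang T := by
  have comm : biproduct.map (fun j => (S j).mor₁) ≫ (biproduct.isoProduct _).hom =
      (biproduct.isoProduct _).hom ≫ Limits.Pi.map fun j => (S j).mor₁ := by
    ext j
    simp
  exact exists_distinguished_of_iso (productTriangle_distinguished S hS) _
    (biproduct.isoProduct _) (biproduct.isoProduct _) (biproduct.isoProduct _) comm

/-- The last summand splits off a biproduct indexed by `Fin (m + 1)`. -/
noncomputable def biproductFinCastSuccIso {T : Type*} [Category T] [Preadditive T]
    [HasBinaryBiproducts T] [HasFiniteBiproducts T] {m : ℕ} (P : Fin (m + 1) → T) :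
    (⨁ fun k : Fin m => P k.castSucc) ⊞ P (Fin.last m) ≅ ⨁ P where
  hom := biprod.desc (biproduct.desc fun k => biproduct.ι P k.castSucc)
    (biproduct.ι P (Fin.last m))
  inv := biprod.lift (biproduct.lift fun k => biproduct.π P k.castSucc)
    (biproduct.π P (Fin.last m))
  hom_inv_id := by
    ext <;> simp [biproduct.ι_π, Fin.castSucc_ne_last, (Fin.castSucc_ne_last _).symm]
  inv_hom_id := by
    rw [← biproduct.total, Fin.sum_univ_castSucc]
    simp [biproduct.lift_desc]

/-- A zero first summand may be dropped from a biproduct indexed by `Fin (m + 1)`. -/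
noncomputable def biproductFinSuccIso {T : Type*} [Category T] [Preadditive T]
    [HasFiniteBiproducts T] {m : ℕ} (P : Fin (m + 1) → T) (hP : IsZero (P 0)) :
    (⨁ fun k : Fin m => P k.succ) ≅ ⨁ P where
  hom := biproduct.desc fun k => biproduct.ι P k.succ
  inv := biproduct.lift fun k => biproduct.π P k.succ
  hom_inv_id := by
    ext
    simp [biproduct.ι_π]
  inv_hom_id := by
    rw [← biproduct.total, Fin.sum_univ_succ, hP.eq_of_tgt (biproduct.π P 0) 0]
    simp [biproduct.lift_desc]

/-- given a sequence `0 = M₀ → M₁ → ⋯ → Mₙ = M` with cones `C_k` of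
`f_k : M_{k-1} ⟶ M_k` (expressed by distinguished triangles
`M_{k-1} → M_k → C_k → M_{k-1}⟦1⟧`), the direct sum of the morphisms `f_k` fits
into a distinguished triangle
`(⊕_{k} M_{k-1}) → (⊕_k M_k) → (⊕_k C_k) → (⊕_k M_{k-1})⟦1⟧`
(note `⊕_k M_{k-1} = ⊕_{k=1}^{n-1} M_k` and `⊕_k M_k = M ⊕ ⊕_{k=1}^{n-1} M_k`
since `M₀ = 0` and `Mₙ = M`). In particular `M ≤_Δ ⊕_{k=1}^{n} C_k`. -/
theorem stmt7 {T : Type*} [Category T] [Preadditive T] [HasZeroObject T] [HasShift T ℤ]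
    [∀ n : ℤ, (shiftFunctor T n).Additive] [Pretriangulated T] [IsTriangulated T]
    [HasBinaryBiproducts T] [HasFiniteBiproducts T]
    (n : ℕ) (hn : 1 ≤ n) (M : Fin (n + 1) → T) (hM0 : IsZero (M 0))
    (f : ∀ k : Fin n, M k.castSucc ⟶ M k.succ)
    (C : Fin n → T)
    (g : ∀ k : Fin n, M k.succ ⟶ C k) (h : ∀ k : Fin n, C k ⟶ (M k.castSucc)⟦(1 : ℤ)⟧)
    (hT : ∀ k : Fin n, Triangle.mk (f k) (g k) (h k) ∈ distTriang T) :
    (∃ (G : (⨁ fun k : Fin n => M k.succ) ⟶ ⨁ C)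
        (H : (⨁ C) ⟶ (⨁ fun k : Fin n => M k.castSucc)⟦(1 : ℤ)⟧),
        Triangle.mk (biproduct.map f) G H ∈ distTriang T) ∧
      Deg T (M (Fin.last n)) (⨁ C) := by
  have hsum := exists_distinguished_biproduct_map _ hT
  refine ⟨hsum, ?_⟩
  obtain ⟨G, H, hGH⟩ := hsum
  obtain ⟨m, rfl⟩ := Nat.exists_eq_succ_of_ne_zero (Nat.one_le_iff_ne_zero.mp hn)
  let e₁ : (⨁ fun k : Fin m => M k.succ.castSucc) ≅ ⨁ fun k : Fin (m + 1) => M k.castSucc :=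
    biproductFinSuccIso (fun k : Fin (m + 1) => M k.castSucc) hM0
  let e₂ : (⨁ fun k : Fin m => M k.succ.castSucc) ⊞ M (Fin.last (m + 1)) ≅
      ⨁ fun k : Fin (m + 1) => M k.succ :=
    biproductFinCastSuccIso fun k : Fin (m + 1) => M k.succ
  let a := e₁.hom ≫ biproduct.map f ≫ e₂.inv
  have ha : biprod.lift (a ≫ biprod.fst) (a ≫ biprod.snd) = a := by
    ext <;> simp
  have comm : biprod.lift (a ≫ biprod.fst) (a ≫ biprod.snd) ≫ e₂.hom =
      e₁.hom ≫ biproduct.map f := by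
    rw [ha]
    simp [a]
  obtain ⟨g', h', hT'⟩ := exists_distinguished_of_iso hGH
    (biprod.lift (a ≫ biprod.fst) (a ≫ biprod.snd)) e₁ e₂ (Iso.refl _) comm
  exact ⟨_, _, _, g', h', hT'⟩
end

section
/- Let R be a ring, S a simple R-module, and k an integer with k ≠ 0 and k ≠ −1. In the derived category of R-modules, let M = S[0] ⊕ S[0]⟦2k+1⟧ (the stalk complex S in degree 0 direct sum its (2k+1)-fold shift). Then there is no object Z whose homology modules Hⁱ(Z) all have finite length (e.g. no object of the bounded derived category of finite-length modules) admitting a morphism f : Z → Z and a distinguished triangle Z →^f Z → M → Z⟦1⟧. In particular [M] = 0 in K₀ but M is not a Δ-degeneration of zero: 0 ≰_Δ M. -/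
open CategoryTheory Category Limits Pretriangulated

namespace ModuleCat

variable {R : Type*} [Ring R]

lemma epi_of_mono_of_isFiniteLength {M : ModuleCat R} (hM : IsFiniteLength R M) (f : M ⟶ M)
    [Mono f] : Epi f := by
  have := (isFiniteLength_iff_isNoetherian_isArtinian.mp hM).2
  exact (ModuleCat.epi_iff_surjective f).mpr
    (IsArtinian.surjective_of_injective_endomorphism f.hom
      ((ModuleCat.mono_iff_injective f).mp inferInstance))

lemma mono_of_epi_of_isFiniteLength {M : ModuleCat R} (hM : IsFiniteLength R M) (f : M ⟶ M)
    [Epi f] : Mono f := by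
  have := (isFiniteLength_iff_isNoetherian_isArtinian.mp hM).1
  exact (ModuleCat.mono_iff_injective f).mpr
    (IsNoetherian.injective_of_surjective_endomorphism f.hom
      ((ModuleCat.epi_iff_surjective f).mp inferInstance))

end ModuleCat

namespace DerivedCategory

variable {C : Type*} [Category* C] [Abelian C] [HasDerivedCategory C]

lemma isZero_homology_singleFunctor_obj (X : C) {n i : ℤ} (hi : i ≠ n) :
    IsZero ((homologyFunctor C i).obj ((singleFunctor C n).obj X)) := by
  rcases lt_or_gt_of_ne hi with h | h
  · exact isZero_of_isGE _ n i h
  · exact isZero_of_isLE _ n i h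

lemma isZero_homology_shift_singleFunctor_obj (X : C) {n m i : ℤ} (hi : m + i ≠ n) :
    IsZero ((homologyFunctor C i).obj (((singleFunctor C n).obj X)⟦m⟧)) :=
  (isZero_homology_singleFunctor_obj X hi).of_iso
    (((homologyFunctor C 0).shiftIso m i (m + i) rfl).app ((singleFunctor C n).obj X))

lemma isZero_homology_biprod {X Y : DerivedCategory C} {i : ℤ}
    (hX : IsZero ((homologyFunctor C i).obj X)) (hY : IsZero ((homologyFunctor C i).obj Y)) :
    IsZero ((homologyFunctor C i).obj (X ⊞ Y)) := by
  rw [IsZero.iff_id_eq_zero, ← CategoryTheory.Functor.map_id, ← biprod.total, Functor.map_add,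
    Functor.map_comp, Functor.map_comp, hX.eq_of_tgt ((homologyFunctor C i).map biprod.fst) 0,
    hY.eq_of_tgt ((homologyFunctor C i).map biprod.snd) 0, zero_comp, zero_comp, add_zero]

/-- If the first morphism of a distinguished triangle is an endomorphism of an object with finite
length homology, and the homology of the third object vanishes in degrees `n - 1` and `n + 1`, then
it also vanishes in degree `n`. -/
lemma isZero_homology_obj₃_of_isFiniteLength {R : Type*} [Ring R]
    [HasDerivedCategory (ModuleCat R)] {Z M : DerivedCategory (ModuleCat R)}
    {f : Z ⟶ Z} {g : Z ⟶ M} {h : M ⟶ Z⟦(1 : ℤ)⟧}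
    (hT : Triangle.mk f g h ∈ distTriang (DerivedCategory (ModuleCat R)))
    (n₀ n₁ n₂ : ℤ) (h₀₁ : n₀ + 1 = n₁) (h₁₂ : n₁ + 1 = n₂)
    (hZ₁ : IsFiniteLength R ((homologyFunctor (ModuleCat R) n₁).obj Z))
    (hZ₂ : IsFiniteLength R ((homologyFunctor (ModuleCat R) n₂).obj Z))
    (hM₀ : IsZero ((homologyFunctor (ModuleCat R) n₀).obj M))
    (hM₂ : IsZero ((homologyFunctor (ModuleCat R) n₂).obj M)) :
    IsZero ((homologyFunctor (ModuleCat R) n₁).obj M) := by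
  have mono₁ : Mono ((homologyFunctor (ModuleCat R) n₁).map f) :=
    (HomologySequence.mono_homologyMap_mor₁_iff _ hT n₀ n₁ h₀₁).mpr (hM₀.eq_of_src _ _)
  have epi₁ := ModuleCat.epi_of_mono_of_isFiniteLength hZ₁
    ((homologyFunctor (ModuleCat R) n₁).map f)
  have epi₂ : Epi ((homologyFunctor (ModuleCat R) n₂).map f) :=
    (HomologySequence.epi_homologyMap_mor₁_iff _ hT n₂).mpr (hM₂.eq_of_tgt _ _)
  have mono₂ := ModuleCat.mono_of_epi_of_isFiniteLength hZ₂
    ((homologyFunctor (ModuleCat R) n₂).map f)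
  have epi_g : Epi ((homologyFunctor (ModuleCat R) n₁).map g) :=
    (HomologySequence.epi_homologyMap_mor₂_iff _ hT n₁ n₂ h₁₂).mpr
      ((HomologySequence.mono_homologyMap_mor₁_iff _ hT n₁ n₂ h₁₂).mp mono₂)
  have g_zero : (homologyFunctor (ModuleCat R) n₁).map g = 0 :=
    (HomologySequence.epi_homologyMap_mor₁_iff _ hT n₁).mp epi₁
  exact IsZero.of_epi_eq_zero _ g_zero

end DerivedCategory

/-- let `R` be a ring, `S` a simple `R`-module and `k ≠ 0, −1` an
integer. In the derived category of `R`-modules, set `M = S[0] ⊕ S[0]⟦2k+1⟧`.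
Then there is no object `Z` all of whose homology modules have finite length,
together with an endomorphism `f : Z ⟶ Z` and a distinguished triangle
`Z →^f Z → M → Z⟦1⟧`; i.e. `M` is not a `Δ`-degeneration of zero within objects
with finite-length homology. -/
theorem stmt10 (R : Type) [Ring R] [HasDerivedCategory (ModuleCat R)]
    (S : ModuleCat R) (hS : IsSimpleModule R S)
    (k : ℤ) (hk0 : k ≠ 0) (hk1 : k ≠ -1) :
    ¬ ∃ (Z : DerivedCategory (ModuleCat R))
        (_ : ∀ i : ℤ,
          IsFiniteLength R ((DerivedCategory.homologyFunctor (ModuleCat R) i).obj Z))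
        (f : Z ⟶ Z)
        (g : Z ⟶ (DerivedCategory.singleFunctor (ModuleCat R) 0).obj S ⊞
          ((DerivedCategory.singleFunctor (ModuleCat R) 0).obj S)⟦(2 * k + 1 : ℤ)⟧)
        (h : ((DerivedCategory.singleFunctor (ModuleCat R) 0).obj S ⊞
          ((DerivedCategory.singleFunctor (ModuleCat R) 0).obj S)⟦(2 * k + 1 : ℤ)⟧) ⟶
            Z⟦(1 : ℤ)⟧),
      Triangle.mk f g h ∈ distTriang (DerivedCategory (ModuleCat R)) := by
  rintro ⟨Z, hZ, f, g, h, hT⟩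
  have hM (i : ℤ) (h₀ : i ≠ 0) (h₁ : 2 * k + 1 + i ≠ 0) :=
    DerivedCategory.isZero_homology_biprod
      (DerivedCategory.isZero_homology_singleFunctor_obj S h₀)
      (DerivedCategory.isZero_homology_shift_singleFunctor_obj S h₁)
  have hM₀ := DerivedCategory.isZero_homology_obj₃_of_isFiniteLength hT (-1) 0 1 rfl rfl
    (hZ 0) (hZ 1) (hM _ (by lia) (by lia)) (hM _ (by lia) (by lia))
  have hS₀ : IsZero ((DerivedCategory.homologyFunctor (ModuleCat R) 0).obj
      ((DerivedCategory.singleFunctor (ModuleCat R) 0).obj S)) :=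
    hM₀.of_mono ((DerivedCategory.homologyFunctor (ModuleCat R) 0).map biprod.inl)
  have hS₁ : Subsingleton S := ModuleCat.isZero_iff_subsingleton.mp
    (hS₀.of_iso ((DerivedCategory.singleFunctorCompHomologyFunctorIso (ModuleCat R) 0).symm.app S))
  have := IsSimpleModule.nontrivial R S
  exact not_subsingleton S hS₁
end

section
/- Let T be a triangulated category with split idempotents (idempotent complete) such that the endomorphism ring End(X) of every object X of T is left Artinian. Then for all objects M, N of T: (i) M ≤_Δ N if and only if M ≤_{Δ+nil} N; and (ii) the relation ≤_Δ is reflexive and transitive on isomorphism classes of objects of T (if M ≤_Δ N and N ≤_Δ P then M ≤_Δ P, and M ≤_Δ M for all M). -/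
open CategoryTheory Category Limits Pretriangulated

section RingFitting

/-- Fitting decomposition of an element `v` of a left Artinian ring: an idempotent `e` commuting
with `v` such that `v` is invertible in the corner of `e` and nilpotent in that of `1 - e`. -/
theorem exists_fitting_idempotent {R : Type*} [Ring R] [IsArtinianRing R] (v : R) :
    ∃ e b : R, ∃ n : ℕ, 0 < n ∧ e * e = e ∧ e * v = v * e ∧ e * b = b ∧ b * e = b ∧
      b * v = e ∧ v * b = e ∧ ((1 - e) * v) ^ n = 0 := by
  have hpow : ∀ (k : ℕ) (r : R), ((LinearMap.toSpanSingleton R R v) ^ k) r = r * v ^ k := by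
    intro k
    induction k with
    | zero => intro r; simp
    | succ k ih => intro r; rw [pow_succ, Module.End.mul_apply, ih]; simp [mul_assoc, pow_succ']
  obtain ⟨n, hn⟩ := Filter.eventually_atTop.mp
    (LinearMap.eventually_isCompl_ker_pow_range_pow (LinearMap.toSpanSingleton R R v))
  have hc := hn (n + 1) (Nat.le_succ n)
  have hmem_ker : ∀ r, r ∈ LinearMap.ker ((LinearMap.toSpanSingleton R R v) ^ (n + 1)) ↔
      r * v ^ (n + 1) = 0 := fun r => by rw [LinearMap.mem_ker, hpow]
  have hmem_range : ∀ r, r ∈ LinearMap.range ((LinearMap.toSpanSingleton R R v) ^ (n + 1)) ↔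
      ∃ a, a * v ^ (n + 1) = r := fun r => by simp only [LinearMap.mem_range, hpow]
  have hdisj : ∀ r : R, r * v ^ (n + 1) = 0 → (∃ a, a * v ^ (n + 1) = r) → r = 0 :=
    fun r h₁ h₂ => Submodule.disjoint_def.mp hc.disjoint r ((hmem_ker r).2 h₁) ((hmem_range r).2 h₂)
  obtain ⟨f, hf, e, he, hfe⟩ := Submodule.mem_sup.mp
    (hc.codisjoint.eq_top ▸ Submodule.mem_top (x := (1 : R)))
  rw [hmem_ker] at hf
  obtain ⟨a, ha⟩ := (hmem_range e).1 he
  obtain rfl : f = 1 - e := eq_sub_of_add_eq hfe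
  have hcomm : v * v ^ (n + 1) = v ^ (n + 1) * v := (pow_mul_comm' v (n + 1)).symm
  have hex : e * v ^ (n + 1) = v ^ (n + 1) := by
    rw [sub_mul, one_mul, sub_eq_zero] at hf
    exact hf.symm
  have hee : e * e = e := by
    refine sub_eq_zero.mp (hdisj _ ?_ ⟨e * a - a, ?_⟩)
    · rw [sub_mul, mul_assoc, hex, hex, sub_self]
    · rw [sub_mul, mul_assoc, ha]
  have hev : e * v = v * e := by
    refine sub_eq_zero.mp (hdisj _ ?_ ⟨a * v - v * a, ?_⟩)
    · rw [sub_mul, mul_assoc, mul_assoc, hex, hcomm, ← mul_assoc, hex, sub_self]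
    · rw [sub_mul, mul_assoc, hcomm, ← mul_assoc, ha, mul_assoc, ha]
  have hev' : ∀ k, e * v ^ k = v ^ k * e := fun k => (Commute.pow_right hev k)
  have hbv : e * (a * v ^ n) * e * v = e := by
    rw [mul_assoc, hev, ← mul_assoc, mul_assoc e, mul_assoc a, ← pow_succ, ha, hee, hee]
  have hnil : ((1 - e) * v) ^ (n + 1) = 0 := by
    rw [((Commute.one_left v).sub_left hev).mul_pow, pow_succ, mul_assoc, hf, mul_zero]
  refine ⟨e, e * (a * v ^ n) * e, n + 1, n.succ_pos, hee, hev, ?_, ?_, hbv, ?_, hnil⟩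
  · rw [← mul_assoc, ← mul_assoc, hee]
  · rw [mul_assoc, hee]
  · refine sub_eq_zero.mp (hdisj _ ?_ ⟨(v * (e * (a * v ^ n) * e) - e) * a, ?_⟩)
    · rw [pow_succ', ← mul_assoc, sub_mul, mul_assoc v, hbv, hev, sub_self, zero_mul]
    · rw [mul_assoc, ha, sub_mul, hee, mul_assoc v, mul_assoc _ e e, hee]

end RingFitting

section Orbit

open scoped ZeroObject

variable {T : Type*} [Category T] [Preadditive T] [HasZeroObject T] [HasBinaryBiproducts T]

/-- For `w : W ⟶ W` and `g : W ⟶ A`, the morphism `(g, w ≫ g, …, w ^ (k - 1) ≫ g)` becomes,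
after precomposition with `w` and addition of the component `g`, isomorphic to itself with
the component `w ^ k ≫ g` added. -/
theorem exists_orbit_morphism {W A : T} (w : W ⟶ W) (g : W ⟶ A) (k : ℕ) :
    ∃ (Y : T) (ψ : W ⟶ Y) (α : Y ⊞ A ≅ Y ⊞ A),
      biprod.lift ψ ((show W ⟶ W from (show End W from w) ^ k) ≫ g) ≫ α.hom =
        biprod.lift (w ≫ ψ) g := by
  induction k with
  | zero =>
    refine ⟨0, 0, Iso.refl _, ?_⟩
    ext
    simp [End.one_def]
  | succ k ih =>
    obtain ⟨Y, ψ, α, h⟩ := ih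
    refine ⟨Y ⊞ A, biprod.lift ψ ((show W ⟶ W from (show End W from w) ^ k) ≫ g),
      biprod.mapIso α (Iso.refl A) ≪≫
        { hom := biprod.lift (biprod.lift (biprod.fst ≫ biprod.fst) biprod.snd)
            (biprod.fst ≫ biprod.snd)
          inv := biprod.lift (biprod.lift (biprod.fst ≫ biprod.fst) biprod.snd)
            (biprod.fst ≫ biprod.snd) }, ?_⟩
    have h₁ := h =≫ biprod.fst
    have h₂ := h =≫ biprod.snd
    simp only [assoc, biprod.lift_fst, biprod.lift_snd] at h₁ h₂
    ext <;> simp [h₁, h₂, pow_succ, End.mul_def]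

end Orbit

section Triangles

open scoped ZeroObject

variable {T : Type*} [Category T] [Preadditive T] [HasZeroObject T] [HasShift T ℤ]
    [∀ n : ℤ, (shiftFunctor T n).Additive] [Pretriangulated T]

/-- Transport of distinguished triangles along isomorphisms of the three objects. -/
theorem exists_distinguished_of_iso_s16 {A B C A' B' C' : T}
    {f : A ⟶ B} {g : B ⟶ C} {h : C ⟶ A⟦(1 : ℤ)⟧} (hT : Triangle.mk f g h ∈ distTriang T)
    (e₁ : A ≅ A') (e₂ : B ≅ B') (e₃ : C ≅ C') {f' : A' ⟶ B'} {g' : B' ⟶ C'}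
    (comm₁ : f ≫ e₂.hom = e₁.hom ≫ f') (comm₂ : g ≫ e₃.hom = e₂.hom ≫ g') :
    ∃ k, Triangle.mk f' g' k ∈ distTriang T :=
  ⟨e₃.inv ≫ h ≫ e₁.hom⟦1⟧', isomorphic_distinguished _ hT _
    (Triangle.isoMk (Triangle.mk f g h) (Triangle.mk f' g' (e₃.inv ≫ h ≫ e₁.hom⟦1⟧'))
      e₁ e₂ e₃ comm₁ comm₂ (e₃.hom_inv_id_assoc _).symm).symm⟩

/-- Objects completing isomorphic morphisms to distinguished triangles are isomorphic. -/
theorem nonempty_iso_of_distinguished {A B C A' B' C' : T}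
    {f : A ⟶ B} {g : B ⟶ C} {h : C ⟶ A⟦(1 : ℤ)⟧} {f' : A' ⟶ B'} {g' : B' ⟶ C'}
    {h' : C' ⟶ A'⟦(1 : ℤ)⟧} (hT : Triangle.mk f g h ∈ distTriang T)
    (hT' : Triangle.mk f' g' h' ∈ distTriang T) (e₁ : A ≅ A') (e₂ : B ≅ B')
    (comm : f ≫ e₂.hom = e₁.hom ≫ f') : Nonempty (C ≅ C') :=
  ⟨Triangle.π₃.mapIso (isoTriangleOfIso₁₂ _ _ hT hT' e₁ e₂ comm)⟩

variable [HasBinaryBiproducts T]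

/-- The product of a family indexed by `WalkingPair` is the biproduct of its two members. -/
noncomputable def piWalkingPairIso (F : WalkingPair → T) : ∏ᶜ F ≅ F .left ⊞ F .right where
  hom := biprod.lift (Pi.π F .left) (Pi.π F .right)
  inv := Pi.lift (fun j => WalkingPair.casesOn j biprod.fst biprod.snd)
  hom_inv_id := by
    refine Pi.hom_ext _ _ ?_
    rintro (_ | _) <;> simp
  inv_hom_id := by ext <;> simp

theorem piWalkingPairIso_hom_naturality {F G : WalkingPair → T} (f : ∀ j, F j ⟶ G j) :
    Limits.Pi.map f ≫ (piWalkingPairIso G).hom =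
      (piWalkingPairIso F).hom ≫ biprod.map (f .left) (f .right) := by
  ext <;> simp [piWalkingPairIso]

theorem exists_distinguished_biprod_of_walkingPair {F G H : WalkingPair → T}
    (f : ∀ j, F j ⟶ G j) (g : ∀ j, G j ⟶ H j) (h : ∀ j, H j ⟶ (F j)⟦(1 : ℤ)⟧)
    (hT : ∀ j, Triangle.mk (f j) (g j) (h j) ∈ distTriang T) :
    ∃ k, Triangle.mk (biprod.map (f .left) (f .right)) (biprod.map (g .left) (g .right)) k ∈
      distTriang T :=
  exists_distinguished_of_iso_s16
    (productTriangle_distinguished (fun j => Triangle.mk (f j) (g j) (h j)) hT)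
    (piWalkingPairIso F) (piWalkingPairIso G) (piWalkingPairIso H)
    (piWalkingPairIso_hom_naturality f) (piWalkingPairIso_hom_naturality g)

/-- The biproduct of two distinguished triangles is distinguished. -/
theorem exists_distinguished_biprod {A B C A' B' C' : T}
    {f : A ⟶ B} {g : B ⟶ C} {h : C ⟶ A⟦(1 : ℤ)⟧} {f' : A' ⟶ B'} {g' : B' ⟶ C'}
    {h' : C' ⟶ A'⟦(1 : ℤ)⟧} (hT : Triangle.mk f g h ∈ distTriang T)
    (hT' : Triangle.mk f' g' h' ∈ distTriang T) :
    ∃ k, Triangle.mk (biprod.map f f') (biprod.map g g') k ∈ distTriang T :=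
  let pair (X Y : T) : WalkingPair → T := fun | .left => X | .right => Y
  exists_distinguished_biprod_of_walkingPair (F := pair A A') (G := pair B B') (H := pair C C')
    (fun | .left => f | .right => f') (fun | .left => g | .right => g')
    (fun | .left => h | .right => h') (fun | .left => hT | .right => hT')

/-- A distinguished triangle `Z → Q → N → Z⟦1⟧` together with isomorphisms `Q ≅ Z ⊞ M` and
`N ≅ P` witnesses `Deg T M P`. -/
theorem Deg.of_distinguished {M N P Z Q : T} {f : Z ⟶ Q} {g : Q ⟶ N} {h : N ⟶ Z⟦(1 : ℤ)⟧}
    (hT : Triangle.mk f g h ∈ distTriang T) (e : Q ≅ Z ⊞ M) (e' : N ≅ P) : Deg T M P := by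
  obtain ⟨k, hk⟩ := exists_distinguished_of_iso_s16 hT (Iso.refl Z) e e'
    (f' := biprod.lift (f ≫ e.hom ≫ biprod.fst) (f ≫ e.hom ≫ biprod.snd))
    (g' := e.inv ≫ g ≫ e'.hom) (by ext <;> simp) (by simp)
  exact ⟨Z, _, _, _, k, hk⟩

theorem DegNil.deg {M N : T} (hMN : DegNil T M N) : Deg T M N :=
  let ⟨Z, v, u, g, h, _, hT⟩ := hMN
  ⟨Z, v, u, g, h, hT⟩

theorem Deg.refl (M : T) : Deg T M M :=
  Deg.of_distinguished (contractible_distinguished₁ M) (isoZeroBiprod (isZero_zero T))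
    (Iso.refl M)

variable [IsTriangulated T]

theorem Deg.trans_degNil {M N P : T} (h₁ : Deg T M N) (h₂ : DegNil T N P) : Deg T M P := by
  obtain ⟨Z, v, u, f, h, hZ⟩ := h₁
  obtain ⟨W, w, n, p, q, ⟨a, -, hw⟩, hW⟩ := h₂
  obtain ⟨Y, ψ, α, hα⟩ := exists_orbit_morphism w (n ≫ h) a
  have hα' : ψ ≫ biprod.inl ≫ α.hom = biprod.lift (w ≫ ψ) (n ≫ h) := by
    rw [← hα, hw, ← assoc]
    congr 1
    ext <;> simp
  obtain ⟨K, κ, δ, hK⟩ := distinguished_cocone_triangle₁ ψ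
  obtain ⟨c, hF⟩ := exists_distinguished_biprod hK (rot_of_distTriang _ hZ)
  obtain ⟨d, hE⟩ := exists_distinguished_biprod hK (contractible_distinguished₂ Z)
  obtain ⟨d', hE'⟩ : ∃ d', Triangle.mk (biprod.map κ (0 : Z ⟶ 0) ≫ biprod.fst)
      (biprod.lift w n ≫ biprod.map ψ h) d' ∈ distTriang T := by
    refine exists_distinguished_of_iso_s16 hE (Iso.refl _) (isoBiprodZero (isZero_zero T)).symm α
      (by simp) ?_
    rw [← cancel_epi (isoBiprodZero (isZero_zero T)).hom, Iso.symm_hom, Iso.hom_inv_id_assoc]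
    ext
    · simpa [isoBiprodZero] using hα' =≫ biprod.fst
    · simpa [isoBiprodZero] using hα' =≫ biprod.snd
  obtain ⟨R, i, r, hP⟩ := distinguished_cocone_triangle₁ (biprod.lift w n)
  obtain ⟨eP⟩ := nonempty_iso_of_distinguished (rot_of_distTriang _ hP) hW (Iso.refl W)
    (Iso.refl (W ⊞ N)) ((comp_id _).trans (id_comp _).symm)
  exact Deg.of_distinguished
    (rot_of_distTriang _ (Triangulated.someOctahedron' rfl hP hF hE').mem)
    (biprod.associator K Z M).symm eP

end Triangles

section Fitting

variable {T : Type*} [Category T] [Preadditive T]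

theorem IsNilpotentEndo.retract {Z Z' : T} {v e : Z ⟶ Z} (hv : IsNilpotentEndo (v ≫ e))
    {i : Z' ⟶ Z} {p : Z ⟶ Z'} (hip : i ≫ p = 𝟙 Z') (hpi : p ≫ i = e) :
    IsNilpotentEndo (i ≫ v ≫ p) := by
  obtain ⟨n, hn, hv⟩ := hv
  have hpow : ∀ k : ℕ, (show Z' ⟶ Z' from (show End Z' from i ≫ v ≫ p) ^ k) =
      i ≫ (show Z ⟶ Z from (show End Z from v ≫ e) ^ k) ≫ p := by
    intro k
    induction k with
    | zero => simp [End.one_def, hip]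
    | succ k ih =>
      simp only [pow_succ, End.mul_def] at ih ⊢
      rw [ih]
      simp [← hpi]
  refine ⟨n, hn, (hpow n).trans ?_⟩
  rw [hv]
  exact (congrArg (i ≫ ·) zero_comp).trans comp_zero

/-- Fitting decomposition of an endomorphism, in terms of an idempotent `e`. -/
theorem exists_fitting_idempotent_hom {Z : T} [IsArtinianRing (End Z)] (v : Z ⟶ Z) :
    ∃ e b : Z ⟶ Z, e ≫ e = e ∧ v ≫ e = e ≫ v ∧ b ≫ e = b ∧ e ≫ b = b ∧ v ≫ b = e ∧
      b ≫ v = e ∧ IsNilpotentEndo (v ≫ (𝟙 Z - e)) := by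
  obtain ⟨e, b, n, hn, hee, hev, heb, hbe, hbv, hvb, hnil⟩ :=
    exists_fitting_idempotent (show End Z from v)
  exact ⟨e, b, hee, hev, heb, hbe, hbv, hvb, n, hn, hnil⟩

end Fitting

theorem Deg.degNil {T : Type*} [Category T] [Preadditive T] [HasZeroObject T] [HasShift T ℤ]
    [∀ n : ℤ, (shiftFunctor T n).Additive] [Pretriangulated T]
    [HasBinaryBiproducts T] [IsIdempotentComplete T]
    (hArt : ∀ X : T, IsArtinianRing (End X)) {M N : T} (hMN : Deg T M N) : DegNil T M N := by
  obtain ⟨Z, v, u, f, h, hZ⟩ := hMN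
  have := hArt Z
  obtain ⟨e, b, hee, hev, heb, hbe, hbv, hvb, hnil⟩ := exists_fitting_idempotent_hom v
  obtain ⟨Z₁, i₁, p₁, hip₁, hpi₁⟩ := IsIdempotentComplete.idempotents_split Z e hee
  obtain ⟨Z₂, i₂, p₂, hip₂, hpi₂⟩ := IsIdempotentComplete.idempotents_split Z (𝟙 Z - e)
    (by simp [hee])
  have hi₁ : i₁ ≫ e = i₁ := by rw [← hpi₁, reassoc_of% hip₁]
  have hp₁ : e ≫ p₁ = p₁ := by rw [← hpi₁, assoc, hip₁, comp_id]
  have hi₂ : i₂ ≫ e = 0 := by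
    have h : i₂ ≫ (𝟙 Z - e) = i₂ := by rw [← hpi₂, reassoc_of% hip₂]
    simpa using h
  have hp₂ : e ≫ p₂ = 0 := by
    have h : (𝟙 Z - e) ≫ p₂ = p₂ := by rw [← hpi₂, assoc, hip₂, comp_id]
    simpa using h
  have hip₁₂ : i₁ ≫ p₂ = 0 := by rw [← hi₁, assoc, hp₂, comp_zero]
  have hip₂₁ : i₂ ≫ p₁ = 0 := by rw [← hp₁, reassoc_of% hi₂, zero_comp]
  have hib : i₂ ≫ b = 0 := by rw [← hbe, reassoc_of% hi₂, zero_comp]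
  have hvp : i₁ ≫ v ≫ p₂ = 0 := by
    rw [← hi₁, assoc, ← reassoc_of% hev, hp₂, comp_zero, comp_zero]
  obtain ⟨N', g', h', hN'⟩ :=
    distinguished_cocone_triangle (biprod.lift (i₂ ≫ v ≫ p₂) (i₂ ≫ u))
  obtain ⟨k, hk⟩ := exists_distinguished_biprod (contractible_distinguished Z₁) hN'
  let e₁ : Z₁ ⊞ Z₂ ≅ Z :=
    { hom := biprod.desc i₁ i₂
      inv := biprod.lift p₁ p₂
      hom_inv_id := by ext <;> simp [hip₁, hip₂, hip₁₂, hip₂₁]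
      inv_hom_id := by simp [hpi₁, hpi₂] }
  let e₂ : Z₁ ⊞ (Z₂ ⊞ M) ≅ Z ⊞ M :=
    { hom := biprod.desc (i₁ ≫ biprod.lift v u) (biprod.desc (i₂ ≫ biprod.inl) biprod.inr)
      inv := biprod.lift (biprod.fst ≫ b ≫ p₁)
        (biprod.lift (biprod.fst ≫ p₂) (biprod.snd - biprod.fst ≫ b ≫ u))
      hom_inv_id := by
        ext <;> simp [reassoc_of% hbv, reassoc_of% hib, reassoc_of% hi₁, hp₁, hip₁, hip₂,
          hvp]
      inv_hom_id := by
        ext <;> simp [reassoc_of% hpi₁, hpi₂, reassoc_of% heb, hvb] }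
  obtain ⟨eN⟩ := nonempty_iso_of_distinguished hk hZ e₁ e₂ (by
    have hiv : i₂ ≫ v ≫ p₂ ≫ i₂ = i₂ ≫ v := by
      rw [hpi₂, Preadditive.comp_sub, comp_id, hev, Preadditive.comp_sub, reassoc_of% hi₂,
        zero_comp, sub_zero]
    ext <;> simp [e₁, e₂, hiv])
  obtain ⟨k', hk'⟩ := exists_distinguished_of_iso_s16 hN' (Iso.refl _) (Iso.refl _)
    (isoZeroBiprod (isZero_zero T) ≪≫ eN)
    ((comp_id (biprod.lift (i₂ ≫ v ≫ p₂) (i₂ ≫ u))).trans (id_comp _).symm) (id_comp _).symm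
  exact ⟨Z₂, i₂ ≫ v ≫ p₂, i₂ ≫ u, _, k', hnil.retract hip₂ hpi₂, hk'⟩

/-- if `T` is a triangulated category with split idempotents and every
endomorphism ring `End X` is left Artinian, then (i) `≤_Δ` coincides with
`≤_{Δ+nil}`, and (ii) `≤_Δ` is reflexive and transitive. -/
theorem stmt16 {T : Type*} [Category T] [Preadditive T] [HasZeroObject T] [HasShift T ℤ]
    [∀ n : ℤ, (shiftFunctor T n).Additive] [Pretriangulated T] [IsTriangulated T]
    [HasBinaryBiproducts T] [IsIdempotentComplete T]
    (hArt : ∀ X : T, IsArtinianRing (End X)) :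
    (∀ M N : T, Deg T M N ↔ DegNil T M N) ∧
    (∀ M : T, Deg T M M) ∧
    (∀ M N P : T, Deg T M N → Deg T N P → Deg T M P) := by
  exact ⟨fun M N => ⟨Deg.degNil hArt, DegNil.deg⟩, Deg.refl,
    fun M N P h₁ h₂ => h₁.trans_degNil (h₂.degNil hArt)⟩
end
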